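/- Let φ = (1+√5)/2 and fix α with φ ≤ α ≤ 2. Suppose γ ≥ 1 is a real number such that γ_ij ≤ γ·γ_ji for every pair of distinct players i, j with w(i,j) > 0 (γ bounds the Maximum Relationship Imbalance). Then the SCG admits an α-approximate equilibrium s whose social welfare satisfies u(s) ≥ max( (α − 1)·A_T , (1/m)·A_T + (α/(γ+1))·P_T ). -/

import Mathlib

open Finset

/-- A social coordination game (SCG): intrinsic weights `w i k`, symmetric nonnegative
coordination weights `cw i j`, and sharing coefficients `gam i j` with
`gam i j + gam j i = 1` for distinct players. -/
structure SCG (N M : Type*) [Fintype N] [DecidableEq N] [Fintype M] [DecidableEq M] where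
  w : N → M → ℝ
  cw : N → N → ℝ
  gam : N → N → ℝ
  w_nonneg : ∀ i k, 0 ≤ w i k
  cw_nonneg : ∀ i j, 0 ≤ cw i j
  cw_symm : ∀ i j, cw i j = cw j i
  gam_nonneg : ∀ i j, 0 ≤ gam i j
  gam_sum : ∀ i j, i ≠ j → gam i j + gam j i = 1

namespace SCG

variable {N M : Type*} [Fintype N] [DecidableEq N] [Fintype M] [DecidableEq M]

/-- Player `i`'s utility under strategy vector `s`. -/
def util (G : SCG N M) (s : N → M) (i : N) : ℝ :=
  G.w i (s i) + ∑ j ∈ univ.filter (fun j => j ≠ i ∧ s j = s i), G.gam i j * G.cw i j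

/-- Social welfare of a strategy vector. -/
def welfare (G : SCG N M) (s : N → M) : ℝ := ∑ i, G.util s i

/-- Pure Nash equilibrium. -/
def NashEq (G : SCG N M) (s : N → M) : Prop :=
  ∀ (i : N) (k : M), G.util (Function.update s i k) i ≤ G.util s i

/-- `α`-approximate equilibrium. -/
def ApproxEq (G : SCG N M) (α : ℝ) (s : N → M) : Prop :=
  ∀ (i : N) (k : M), G.util (Function.update s i k) i ≤ α * G.util s i


/-- `A_T = Σ_i max_k w_i^k`: total intrinsic utility of players' favorite strategies. -/
def totalIntrinsic [Nonempty M] (G : SCG N M) : ℝ :=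
  ∑ i, univ.sup' univ_nonempty (G.w i)

/-- `P_T = Σ_{unordered pairs {i,j}} w(i,j)`, written as half the sum over ordered
distinct pairs. -/
noncomputable def totalPair (G : SCG N M) : ℝ :=
  (1 / 2) * ∑ i, ∑ j ∈ univ.filter (fun j => j ≠ i), G.cw i j

/-- The sum of `f` over the players other than `i` who play `k` in `s`. -/
def groupSum (s : N → M) (i : N) (k : M) (f : N → ℝ) : ℝ :=
  ∑ j ∈ univ.filter (fun j => j ≠ i ∧ s j = k), f j

omit [Fintype M] in
lemma groupSum_nonneg (s : N → M) (i : N) (k : M) {f : N → ℝ} (hf : ∀ j, 0 ≤ f j) :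
    0 ≤ groupSum s i k f :=
  sum_nonneg fun j _ => hf j

omit [Fintype M] in
lemma groupSum_update_self (s : N → M) (i : N) (b k : M) (f : N → ℝ) :
    groupSum (Function.update s i b) i k f = groupSum s i k f := by
  unfold groupSum
  congr 1
  ext j
  by_cases h : j = i <;> simp [h]

omit [Fintype M] in
lemma groupSum_update_of_ne (s : N → M) {i i₀ : N} (hi : i₀ ≠ i) (b k : M) (f : N → ℝ) :
    groupSum (Function.update s i₀ b) i k f + (if s i₀ = k then f i₀ else 0)
      = groupSum s i k f + (if b = k then f i₀ else 0) := by
  unfold groupSum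
  rw [sum_filter, sum_filter, ← add_sum_erase _ _ (mem_univ i₀),
    ← add_sum_erase (a := i₀) univ (fun j => if j ≠ i ∧ s j = k then f j else 0) (mem_univ i₀)]
  have h : ∑ j ∈ univ.erase i₀, (if j ≠ i ∧ Function.update s i₀ b j = k then f j else 0)
      = ∑ j ∈ univ.erase i₀, (if j ≠ i ∧ s j = k then f j else 0) := by
    refine sum_congr rfl fun j hj => ?_
    rw [Function.update_of_ne (ne_of_mem_erase hj)]
  rw [h]
  simp only [Function.update_self, ne_eq, hi, not_false_eq_true, true_and]
  ring

/-- The utility player `i` would obtain by playing `k` against the others' choices in `s`. -/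
def utilAt (G : SCG N M) (s : N → M) (i : N) (k : M) : ℝ :=
  G.w i k + groupSum s i k (fun j => G.gam i j * G.cw i j)

lemma util_eq_utilAt (G : SCG N M) (s : N → M) (i : N) : G.util s i = G.utilAt s i (s i) := rfl

lemma util_update (G : SCG N M) (s : N → M) (i : N) (k : M) :
    G.util (Function.update s i k) i = G.utilAt s i k := by
  rw [util_eq_utilAt, Function.update_self, utilAt, utilAt, groupSum_update_self]

lemma share_nonneg (G : SCG N M) (i j : N) : 0 ≤ G.gam i j * G.cw i j :=
  mul_nonneg (G.gam_nonneg i j) (G.cw_nonneg i j)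

lemma w_le_utilAt (G : SCG N M) (s : N → M) (i : N) (k : M) : G.w i k ≤ G.utilAt s i k :=
  le_add_of_nonneg_right (groupSum_nonneg s i k (G.share_nonneg i))

lemma utilAt_nonneg (G : SCG N M) (s : N → M) (i : N) (k : M) : 0 ≤ G.utilAt s i k :=
  (G.w_nonneg i k).trans (G.w_le_utilAt s i k)

lemma cw_le_mul_share (G : SCG N M) {γ : ℝ}
    (hMRI : ∀ i j : N, i ≠ j → 0 < G.cw i j → G.gam i j ≤ γ * G.gam j i)
    {i j : N} (hij : j ≠ i) : G.cw i j ≤ (γ + 1) * (G.gam i j * G.cw i j) := by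
  rcases (G.cw_nonneg i j).eq_or_lt with h | h
  · simp [← h]
  · have h1 := hMRI j i hij (by rwa [G.cw_symm])
    have h2 := G.gam_sum j i hij
    nlinarith

lemma groupSum_cw_le (G : SCG N M) {γ : ℝ} (hγ : 1 ≤ γ)
    (hMRI : ∀ i j : N, i ≠ j → 0 < G.cw i j → G.gam i j ≤ γ * G.gam j i)
    (s : N → M) (i : N) (k : M) :
    groupSum s i k (G.cw i) / (γ + 1) ≤ groupSum s i k (fun j => G.gam i j * G.cw i j) := by
  rw [div_le_iff₀' (by linarith), groupSum, groupSum, mul_sum]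
  exact sum_le_sum fun j hj => G.cw_le_mul_share hMRI (mem_filter.mp hj).2.1

/-- A player away from `k` contributes her utility; a player at `k` contributes her intrinsic
weight and the fraction `c / 2` of her coordination weight towards others at `k`. -/
noncomputable def credit (G : SCG N M) (k : M) (c : ℝ) (s : N → M) (i : N) : ℝ :=
  if s i = k then G.w i k + c / 2 * groupSum s i k (G.cw i) else G.util s i

/-- The properties preserved when players at `k` leave, one at a time, for a best response that
improves their utility by more than a factor `t`. -/
structure DepartureInvariant (G : SCG N M) (k : M) (α t c : ℝ) (s : N → M) : Prop where
  base : ∀ i, s i ≠ k → t * G.utilAt s i k ≤ G.util s i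
  other : ∀ i, s i ≠ k → ∀ k', k' ≠ k →
    G.utilAt s i k' + groupSum s i k (fun j => G.gam i j * G.cw i j) ≤ α * G.util s i
  intrinsic : ∀ i, s i ≠ k → ∀ k', G.w i k' ≤ G.util s i
  credit_le : ∑ i, G.w i k + c * G.totalPair ≤ ∑ i, G.credit k c s i

lemma departureInvariant_const (G : SCG N M) (k : M) (α t c : ℝ) :
    G.DepartureInvariant k α t c (fun _ => k) where
  base _ h := absurd rfl h
  other _ h := absurd rfl h
  intrinsic _ h := absurd rfl h
  credit_le := by
    simp only [credit, if_true, sum_add_distrib, groupSum, and_true, ← mul_sum, totalPair]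
    linarith

lemma DepartureInvariant.update {G : SCG N M} {k : M} {α t γ : ℝ} {s : N → M}
    (hs : G.DepartureInvariant k α t (t / (γ + 1)) s)
    (ht1 : 1 ≤ t) (hα0 : 0 ≤ α) (ht : t + 1 ≤ α * t) (hγ : 1 ≤ γ)
    (hMRI : ∀ i j : N, i ≠ j → 0 < G.cw i j → G.gam i j ≤ γ * G.gam j i)
    {i₀ : N} (hi₀ : s i₀ = k) {b : M} (hbk : b ≠ k)
    (hbest : ∀ k', G.utilAt s i₀ k' ≤ G.utilAt s i₀ b)
    (himp : t * G.utilAt s i₀ k ≤ G.utilAt s i₀ b) :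
    G.DepartureInvariant k α t (t / (γ + 1)) (Function.update s i₀ b) := by
  have hutil : ∀ i, i ≠ i₀ → s i ≠ k →
      G.util (Function.update s i₀ b) i = G.util s i
        + (if b = s i then G.gam i i₀ * G.cw i i₀ else 0) := by
    intro i hi hik
    have h := groupSum_update_of_ne s (Ne.symm hi) b (s i) (fun j => G.gam i j * G.cw i j)
    rw [if_neg (by rw [hi₀]; exact Ne.symm hik)] at h
    rw [util_eq_utilAt, util_eq_utilAt, utilAt, utilAt, Function.update_of_ne hi]
    linarith
  have hmono : ∀ i, i ≠ i₀ → s i ≠ k → G.util s i ≤ G.util (Function.update s i₀ b) i := by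
    intro i hi hik
    rw [hutil i hi hik]
    have := G.share_nonneg i i₀
    split_ifs <;> linarith
  have hdrop : ∀ i, i ≠ i₀ → ∀ f : N → ℝ,
      groupSum (Function.update s i₀ b) i k f + f i₀ = groupSum s i k f := by
    intro i hi f
    have h := groupSum_update_of_ne s (Ne.symm hi) b k f
    rw [if_pos hi₀, if_neg hbk] at h
    linarith
  have hself : ∀ k', G.utilAt (Function.update s i₀ b) i₀ k' = G.utilAt s i₀ k' := by
    intro k'
    rw [utilAt, utilAt, groupSum_update_self]
  refine ⟨?_, ?_, ?_, ?_⟩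
  · intro i hik
    by_cases hi : i = i₀
    · subst hi
      rwa [hself, util_update]
    · rw [Function.update_of_ne hi] at hik
      refine le_trans (mul_le_mul_of_nonneg_left ?_ (by linarith))
        ((hs.base i hik).trans (hmono i hi hik))
      have h := hdrop i hi (fun j => G.gam i j * G.cw i j)
      have := G.share_nonneg i i₀
      unfold utilAt
      linarith
  · intro i hik k' hk'
    by_cases hi : i = i₀
    · subst hi
      rw [hself, util_update, groupSum_update_self]
      have h1 := hbest k'
      have h2 : groupSum s i k (fun j => G.gam i j * G.cw i j) ≤ G.utilAt s i k :=
        le_add_of_nonneg_left (G.w_nonneg i k)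
      have h3 := G.utilAt_nonneg s i b
      have h4 : t * (G.utilAt s i b + G.utilAt s i k) ≤ t * (α * G.utilAt s i b) := by
        nlinarith
      have h5 := le_of_mul_le_mul_left h4 (by linarith)
      linarith
    · rw [Function.update_of_ne hi] at hik
      refine le_trans ?_ ((hs.other i hik k' hk').trans
        (mul_le_mul_of_nonneg_left (hmono i hi hik) hα0))
      have h := hdrop i hi (fun j => G.gam i j * G.cw i j)
      have h' := groupSum_update_of_ne s (Ne.symm hi) b k' (fun j => G.gam i j * G.cw i j)
      rw [if_neg (by rw [hi₀]; exact Ne.symm hk')] at h'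
      have := G.share_nonneg i i₀
      unfold utilAt
      split_ifs at h' <;> linarith
  · intro i hik k'
    by_cases hi : i = i₀
    · subst hi
      rw [util_update]
      exact (G.w_le_utilAt s i k').trans (hbest k')
    · rw [Function.update_of_ne hi] at hik
      exact (hs.intrinsic i hik k').trans (hmono i hi hik)
  · refine hs.credit_le.trans ?_
    set c := t / (γ + 1) with hc
    rw [← add_sum_erase univ (G.credit k c s) (mem_univ i₀),
      ← add_sum_erase univ (G.credit k c (Function.update s i₀ b)) (mem_univ i₀)]
    have hrest : ∀ i ∈ univ.erase i₀, G.credit k c s i ≤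
        G.credit k c (Function.update s i₀ b) i
          + c / 2 * (if s i = k then G.cw i₀ i else 0) := by
      intro i hi
      have hi := ne_of_mem_erase hi
      by_cases hik : s i = k
      · have h := hdrop i hi (G.cw i)
        rw [credit, credit, Function.update_of_ne hi, if_pos hik, if_pos hik, if_pos hik,
          G.cw_symm i₀ i, ← h]
        linarith
      · rw [credit, credit, Function.update_of_ne hi, if_neg hik, if_neg hik, if_neg hik]
        linarith [hmono i hi hik]
    have hsum := sum_le_sum hrest
    rw [sum_add_distrib, ← mul_sum] at hsum
    have hgroup : ∑ i ∈ univ.erase i₀, (if s i = k then G.cw i₀ i else 0)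
        = groupSum s i₀ k (G.cw i₀) := by
      rw [groupSum, ← sum_filter]
      congr 1
      ext j
      simp
    rw [hgroup] at hsum
    have hleft : G.credit k c s i₀ = G.w i₀ k + c / 2 * groupSum s i₀ k (G.cw i₀) := by
      rw [credit, if_pos hi₀]
    have hright : G.credit k c (Function.update s i₀ b) i₀ = G.utilAt s i₀ b := by
      rw [credit, Function.update_self, if_neg hbk, util_update]
    have hshare := mul_le_mul_of_nonneg_left (G.groupSum_cw_le hγ hMRI s i₀ k)
      (by linarith : 0 ≤ t)
    have hcg : t * (groupSum s i₀ k (G.cw i₀) / (γ + 1)) = c * groupSum s i₀ k (G.cw i₀) := by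
      rw [hc]
      ring
    have hw : G.w i₀ k ≤ t * G.w i₀ k := le_mul_of_one_le_left (G.w_nonneg i₀ k) ht1
    rw [utilAt, mul_add] at himp
    rw [hleft, hright]
    linarith

/-- Letting players leave the common strategy `k` for sufficiently better responses ends in an
approximate equilibrium. -/
lemma exists_approxEq_of_departures [Nonempty M] (G : SCG N M) (k : M) {α t γ : ℝ}
    (ht1 : 1 ≤ t) (ht2 : t ≤ 2) (htα : t ≤ α) (ht : t + 1 ≤ α * t) (hγ : 1 ≤ γ)
    (hMRI : ∀ i j : N, i ≠ j → 0 < G.cw i j → G.gam i j ≤ γ * G.gam j i) :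
    ∃ s : N → M, G.ApproxEq α s ∧ (∀ i k', G.w i k' ≤ t * G.util s i) ∧
      ∑ i, G.w i k + t / (γ + 1) * G.totalPair ≤ G.welfare s := by
  obtain ⟨s, hs, hmin⟩ := Set.exists_min_image
    {s : N → M | G.DepartureInvariant k α t (t / (γ + 1)) s}
    (fun s => (univ.filter fun i => s i = k).card) (Set.toFinite _)
    ⟨_, G.departureInvariant_const k α t _⟩
  have hs : G.DepartureInvariant k α t (t / (γ + 1)) s := hs
  have hstay : ∀ i, s i = k → ∀ k', G.utilAt s i k' ≤ t * G.utilAt s i k := by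
    intro i hi k'
    by_contra! hlt
    obtain ⟨b, hb⟩ := Finite.exists_max (G.utilAt s i)
    have himp := hlt.trans_le (hb k')
    have hbk : b ≠ k := by
      rintro rfl
      nlinarith [G.utilAt_nonneg s i b]
    have hnew := hs.update ht1 (by linarith) ht hγ hMRI hi hbk hb himp.le
    refine (hmin _ hnew).not_gt (card_lt_card ?_)
    refine (ssubset_iff_of_subset ?_).2 ⟨i, by simpa using hi, by simpa using hbk⟩
    intro j
    by_cases hj : j = i <;> simp [hj, hbk]
  have hnonneg : ∀ i, 0 ≤ G.util s i := fun i => G.utilAt_nonneg s i _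
  refine ⟨s, ?_, ?_, hs.credit_le.trans (sum_le_sum ?_)⟩
  · intro i k'
    rw [util_update]
    by_cases hi : s i = k
    · refine (hstay i hi k').trans ?_
      rw [util_eq_utilAt, hi]
      exact mul_le_mul_of_nonneg_right htα (G.utilAt_nonneg s i k)
    · by_cases hk' : k' = k
      · subst hk'
        have h1 := hs.base i hi
        have h2 := G.utilAt_nonneg s i k'
        have h3 := hnonneg i
        nlinarith
      · have h1 := hs.other i hi k' hk'
        have h2 := groupSum_nonneg s i k (G.share_nonneg i)
        linarith
  · intro i k'
    by_cases hi : s i = k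
    · refine (G.w_le_utilAt s i k').trans ?_
      rw [util_eq_utilAt, hi]
      exact hstay i hi k'
    · exact (hs.intrinsic i hi k').trans (le_mul_of_one_le_left (hnonneg i) ht1)
  · intro i _
    by_cases hi : s i = k
    · rw [credit, if_pos hi, util_eq_utilAt, hi, utilAt]
      have h1 := G.groupSum_cw_le hγ hMRI s i k
      have h2 : 0 ≤ groupSum s i k (G.cw i) / (γ + 1) :=
        div_nonneg (groupSum_nonneg s i k (G.cw_nonneg i)) (by linarith)
      have h3 : t / (γ + 1) / 2 * groupSum s i k (G.cw i)
          = t / 2 * (groupSum s i k (G.cw i) / (γ + 1)) := by ring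
      rw [h3]
      nlinarith
    · rw [credit, if_neg hi]

lemma exists_totalIntrinsic_div_le [Nonempty M] (G : SCG N M) :
    ∃ k, 1 / (Fintype.card M : ℝ) * G.totalIntrinsic ≤ ∑ i, G.w i k := by
  obtain ⟨k, hk⟩ := Finite.exists_max fun k => ∑ i, G.w i k
  refine ⟨k, ?_⟩
  have hcard : (0 : ℝ) < Fintype.card M := by exact_mod_cast Fintype.card_pos
  rw [one_div, inv_mul_le_iff₀ hcard]
  calc G.totalIntrinsic ≤ ∑ i, ∑ k', G.w i k' := by
        refine sum_le_sum fun i _ => sup'_le _ _ fun k' _ => ?_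
        exact single_le_sum (f := G.w i) (fun l _ => G.w_nonneg i l) (mem_univ k')
    _ = ∑ k', ∑ i, G.w i k' := sum_comm
    _ ≤ ∑ _k' : M, ∑ i, G.w i k := sum_le_sum fun k' _ => hk k'
    _ = Fintype.card M * ∑ i, G.w i k := by simp

/-- For `φ ≤ α ≤ 2` and a bound `γ ≥ 1` on the Maximum Relationship Imbalance, there is
an `α`-approximate equilibrium with welfare at least
`max((α-1)·A_T, (1/m)·A_T + (α/(γ+1))·P_T)`. -/
theorem exists_approx_with_welfare [Nonempty N] [Nonempty M] (G : SCG N M)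
    (α γ : ℝ)
    (hα1 : (1 + Real.sqrt 5) / 2 ≤ α) (hα2 : α ≤ 2)
    (hγ : 1 ≤ γ)
    (hMRI : ∀ i j : N, i ≠ j → 0 < G.cw i j → G.gam i j ≤ γ * G.gam j i) :
    ∃ s : N → M, G.ApproxEq α s ∧
      max ((α - 1) * G.totalIntrinsic)
          ((1 / (Fintype.card M : ℝ)) * G.totalIntrinsic + (α / (γ + 1)) * G.totalPair)
        ≤ G.welfare s := by
  have hsq : Real.sqrt 5 ^ 2 = 5 := Real.sq_sqrt (by norm_num)
  have hpos := Real.sqrt_nonneg 5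
  have hgold : α + 1 ≤ α * α := by nlinarith
  have hα : 1 < α := by nlinarith
  obtain ⟨k, hk⟩ := G.exists_totalIntrinsic_div_le
  obtain ⟨s, hs, -, hwel⟩ := G.exists_approxEq_of_departures k hα.le hα2 le_rfl hgold hγ hMRI
  have hα' : 0 < α - 1 := by linarith
  have ht1 : 1 ≤ 1 / (α - 1) := by
    rw [le_div_iff₀ hα']
    linarith
  have htα : 1 / (α - 1) ≤ α := by
    rw [div_le_iff₀ hα']
    linarith
  have ht : 1 / (α - 1) + 1 ≤ α * (1 / (α - 1)) := by
    refine le_of_eq ?_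
    field_simp
    ring
  obtain ⟨s', hs', hint, -⟩ :=
    G.exists_approxEq_of_departures k ht1 (htα.trans hα2) htα ht hγ hMRI
  have hwel' : (α - 1) * G.totalIntrinsic ≤ G.welfare s' := by
    rw [totalIntrinsic, mul_sum]
    refine sum_le_sum fun i _ => ?_
    rw [← le_div_iff₀' hα']
    refine sup'_le _ _ fun k' _ => (hint i k').trans_eq ?_
    ring
  rcases le_total ((α - 1) * G.totalIntrinsic)
    ((1 / (Fintype.card M : ℝ)) * G.totalIntrinsic + (α / (γ + 1)) * G.totalPair) with h | h
  · exact ⟨s, hs, by rw [max_eq_right h]; linarith⟩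
  · exact ⟨s', hs', by rwa [max_eq_left h]⟩

end SCG
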